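/- Suppose V̂ satisfies the Bellman equation for π, and define the advantage A(a,s₀) = r(s₀,a) + γ·Σ_{s'} P(s'|s₀,a)·V̂(s') − V̂(s₀). Then for any two distinct actions a ≠ a': cov_π(Â^MC_N(a), Â^MC_N(a') | S_0 = s) = −A(a,s)·A(a',s). -/

import Mathlib

open Finset

attribute [local instance] Classical.propDecidable

namespace HCA

/-- A trajectory of horizon `N`: the actions taken at steps `0, …, N-1` and the
states reached after each step (the start state is fixed separately). -/
abbrev Traj (S A : Type*) (N : ℕ) : Type _ := (Fin N → A) × (Fin N → S)

variable {S A : Type*} [Fintype S] [Fintype A] [Nonempty S] [Nonempty A]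

/-- The state `S_k` of a trajectory with start state `s`. -/
def st {N : ℕ} (s : S) (τ : Traj S A N) : ℕ → S
  | 0 => s
  | k + 1 => if h : k < N then τ.2 ⟨k, h⟩ else s

/-- The action `A_k` of a trajectory. -/
noncomputable def ac {N : ℕ} (τ : Traj S A N) (k : ℕ) : A :=
  if h : k < N then τ.1 ⟨k, h⟩ else Classical.arbitrary A

/-- The probability `P_π(τ) = ∏_{k=0}^{N-1} π(A_k|S_k)·P(S_{k+1}|S_k,A_k)` of a
trajectory starting at `s`. -/
noncomputable def trajP (π : S → A → ℝ) (P : S → A → S → ℝ) (s : S) (N : ℕ)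
    (τ : Traj S A N) : ℝ :=
  ∏ k : Fin N, π (st s τ k) (τ.1 k) * P (st s τ k) (τ.1 k) (st s τ (k + 1))

/-- Expectation `E_π[f | S_0 = s]` over trajectories. -/
noncomputable def expct (π : S → A → ℝ) (P : S → A → S → ℝ) (s : S) (N : ℕ)
    (f : Traj S A N → ℝ) : ℝ :=
  ∑ τ : Traj S A N, trajP π P s N τ * f τ

/-- Variance `Var_π(f | S_0 = s)` over trajectories. -/
noncomputable def vr (π : S → A → ℝ) (P : S → A → S → ℝ) (s : S) (N : ℕ)
    (f : Traj S A N → ℝ) : ℝ :=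
  expct π P s N (fun τ => (f τ - expct π P s N f) ^ 2)

/-- Covariance `cov_π(f, g | S_0 = s)` over trajectories. -/
noncomputable def cv (π : S → A → ℝ) (P : S → A → S → ℝ) (s : S) (N : ℕ)
    (f g : Traj S A N → ℝ) : ℝ :=
  expct π P s N (fun τ => (f τ - expct π P s N f) * (g τ - expct π P s N g))

/-- Probability `P_π(E | S_0 = s)` of an event `E` on trajectories. -/
noncomputable def prE (π : S → A → ℝ) (P : S → A → S → ℝ) (s : S) (N : ℕ)
    (E : Traj S A N → Prop) : ℝ :=
  ∑ τ : Traj S A N, if E τ then trajP π P s N τ else 0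

/-- The TD error `δ_k = r(S_k,A_k) + γ·V̂(S_{k+1}) − V̂(S_k)`. -/
noncomputable def td (r : S → A → ℝ) (γ : ℝ) (V : S → ℝ) (s : S) {N : ℕ}
    (τ : Traj S A N) (k : ℕ) : ℝ :=
  r (st s τ k) (ac τ k) + γ * V (st s τ (k + 1)) - V (st s τ k)

/-- `p_k(s'|s,a) = P_π(S_k = s' | S_0 = s, A_0 = a)
  = P_π(A_0 = a, S_k = s' | S_0 = s) / π(a|s)`. -/
noncomputable def pkSA (π : S → A → ℝ) (P : S → A → S → ℝ) (s : S) (N k : ℕ)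
    (a : A) (s' : S) : ℝ :=
  prE π P s N (fun τ => ac τ 0 = a ∧ st s τ k = s') / π s a

/-- `p_k(s'|s) = Σ_a π(a|s)·p_k(s'|s,a)`. -/
noncomputable def pkS (π : S → A → ℝ) (P : S → A → S → ℝ) (s : S) (N k : ℕ)
    (s' : S) : ℝ :=
  ∑ a : A, π s a * pkSA π P s N k a s'

/-- The hindsight probability `p_k(a|s,s')`, defined as
`P_π(A_0 = a, S_k = s' | S_0 = s)/p_k(s'|s)` when `p_k(s'|s) > 0` and `0` otherwise. -/
noncomputable def pkA (π : S → A → ℝ) (P : S → A → S → ℝ) (s : S) (N k : ℕ)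
    (a : A) (s' : S) : ℝ :=
  if 0 < pkS π P s N k s' then
    prE π P s N (fun τ => ac τ 0 = a ∧ st s τ k = s') / pkS π P s N k s'
  else 0

/-- The `N`-step Monte-Carlo advantage estimator
`Â^MC_N(a) = (1(A_0=a)/π(a|s))·Σ_{k=0}^{N−1} γ^k·δ_k`. -/
noncomputable def mcEst (π : S → A → ℝ) (r : S → A → ℝ) (γ : ℝ) (V : S → ℝ)
    (s : S) (N : ℕ) (a : A) (τ : Traj S A N) : ℝ :=
  ((if ac τ 0 = a then (1 : ℝ) else 0) / π s a) * ∑ k ∈ range N, γ ^ k * td r γ V s τ k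

/-- The `N`-step δHCA advantage estimator
`Â^δHCA_N(a) = (1(A_0=a)/π(a|s))·δ_0 + Σ_{k=1}^{N−1} γ^k·(p_k(a|s,S_k)/π(a|s))·δ_k`. -/
noncomputable def dhcaEst (π : S → A → ℝ) (P : S → A → S → ℝ) (r : S → A → ℝ)
    (γ : ℝ) (V : S → ℝ) (s : S) (N : ℕ) (a : A) (τ : Traj S A N) : ℝ :=
  ((if ac τ 0 = a then (1 : ℝ) else 0) / π s a) * td r γ V s τ 0
    + ∑ k ∈ Ico 1 N, γ ^ k * (pkA π P s N k a (st s τ k) / π s a) * td r γ V s τ k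

/-- `V` satisfies the Bellman equation for `π`:
`V(s₀) = Σ_a π(a|s₀)·(r(s₀,a) + γ·Σ_{s'} P(s'|s₀,a)·V(s'))` for every state `s₀`. -/
def IsBellman (π : S → A → ℝ) (P : S → A → S → ℝ) (r : S → A → ℝ) (γ : ℝ)
    (V : S → ℝ) : Prop :=
  ∀ s₀ : S, V s₀ = ∑ a : A, π s₀ a * (r s₀ a + γ * ∑ s' : S, P s₀ a s' * V s')

/-- The conditional second moment `E_π[δ_k² | S_0 = s, S_k = s']`,
defined as `(Σ_{τ : S_k = s'} P_π(τ)·δ_k(τ)²)/p_k(s'|s)`. -/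
noncomputable def sndMom (π : S → A → ℝ) (P : S → A → S → ℝ) (r : S → A → ℝ)
    (γ : ℝ) (V : S → ℝ) (s : S) (N k : ℕ) (s' : S) : ℝ :=
  (∑ τ : Traj S A N, if st s τ k = s' then trajP π P s N τ * (td r γ V s τ k) ^ 2 else 0)
    / pkS π P s N k s'

/-- Prepend a first action and a first reached state to a trajectory. -/
def consT {N : ℕ} (a : A) (x : S) (τ : Traj S A N) : Traj S A (N + 1) :=
  (Fin.cons a τ.1, Fin.cons x τ.2)

theorem st_cons {S A : Type*} {N : ℕ} (s : S) (a : A) (x : S) (τ : Traj S A N) (k : ℕ)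
    (hk : k ≤ N) : st s (consT a x τ) (k + 1) = st x τ k := by
  cases k with
  | zero => simp [st, consT]
  | succ k =>
    have h1 : k < N := hk
    have h2 : k + 1 < N + 1 := by omega
    simp only [st, h1, h2, dif_pos, consT]
    exact Fin.cons_succ (α := fun _ => S) x τ.2 ⟨k, h1⟩

theorem ac_cons_zero {S A : Type*} [Nonempty A] {N : ℕ} (a : A) (x : S) (τ : Traj S A N) :
    ac (consT a x τ) 0 = a := by
  simp [ac, consT]

theorem ac_cons_succ {S A : Type*} [Nonempty A] {N : ℕ} (a : A) (x : S) (τ : Traj S A N)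
    (k : ℕ) (hk : k < N) : ac (consT a x τ) (k + 1) = ac τ k := by
  have h2 : k + 1 < N + 1 := by omega
  simp only [ac, hk, h2, dif_pos, consT]
  exact Fin.cons_succ (α := fun _ => A) a τ.1 ⟨k, hk⟩

theorem trajP_cons {S A : Type*} (π : S → A → ℝ)
    (P : S → A → S → ℝ) (s : S) (N : ℕ) (a : A) (x : S) (τ : Traj S A N) :
    trajP π P s (N + 1) (consT a x τ) = π s a * P s a x * trajP π P x N τ := by
  unfold trajP
  rw [Fin.prod_univ_succ]
  refine congrArg₂ (· * ·) rfl ?_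
  · refine Finset.prod_congr rfl fun k _ => ?_
    have h1 := st_cons s a x τ k k.2.le
    have h2 := st_cons s a x τ (k + 1) k.2
    simp only [Fin.val_succ, h1, h2]
    rfl

/-- Trajectories of horizon `N + 1` are a first action, a first state, and a tail. -/
def consE (S A : Type*) (N : ℕ) : (A × S × Traj S A N) ≃ Traj S A (N + 1) where
  toFun p := consT p.1 p.2.1 p.2.2
  invFun τ := (τ.1 0, τ.2 0, (Fin.tail τ.1, Fin.tail τ.2))
  left_inv p := by simp [consT]
  right_inv τ := by simp [consT]

theorem expct_succ {S A : Type*} [Fintype S] [Fintype A] (π : S → A → ℝ)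
    (P : S → A → S → ℝ) (s : S) (N : ℕ) (f : Traj S A (N + 1) → ℝ) :
    expct π P s (N + 1) f
      = ∑ a : A, π s a * ∑ x : S, P s a x * expct π P x N (fun τ => f (consT a x τ)) := by
  unfold expct
  rw [← (consE S A N).sum_comp, Fintype.sum_prod_type]
  refine Finset.sum_congr rfl fun a _ => ?_
  rw [Fintype.sum_prod_type, Finset.mul_sum]
  refine Finset.sum_congr rfl fun x _ => ?_
  rw [Finset.mul_sum, Finset.mul_sum]
  refine Finset.sum_congr rfl fun τ _ => ?_
  change trajP π P s (N + 1) (consT a x τ) * f (consT a x τ) = _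
  rw [trajP_cons]
  ring

theorem expct_const {S A : Type*} [Fintype S] [Fintype A] (π : S → A → ℝ)
    (P : S → A → S → ℝ) (hπsum : ∀ s₀ : S, ∑ a : A, π s₀ a = 1)
    (hPsum : ∀ (s₀ : S) (a : A), ∑ s' : S, P s₀ a s' = 1) (N : ℕ) (c : ℝ) :
    ∀ s : S, expct π P s N (fun _ => c) = c := by
  induction N with
  | zero => intro s; simp [expct, trajP]
  | succ N ih =>
    intro s
    rw [expct_succ]
    simp only [ih, ← Finset.sum_mul, hPsum, one_mul, hπsum]

theorem expct_add {S A : Type*} [Fintype S] [Fintype A] (π : S → A → ℝ)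
    (P : S → A → S → ℝ) (s : S) (N : ℕ) (f g : Traj S A N → ℝ) :
    expct π P s N (fun τ => f τ + g τ) = expct π P s N f + expct π P s N g := by
  simp only [expct, mul_add, Finset.sum_add_distrib]

theorem expct_smul {S A : Type*} [Fintype S] [Fintype A] (π : S → A → ℝ)
    (P : S → A → S → ℝ) (s : S) (N : ℕ) (c : ℝ) (f : Traj S A N → ℝ) :
    expct π P s N (fun τ => c * f τ) = c * expct π P s N f := by
  simp only [expct, Finset.mul_sum]
  exact Finset.sum_congr rfl fun τ _ => by ring

/-- The discounted sum of TD errors. -/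
noncomputable def ret (r : S → A → ℝ) (γ : ℝ) (V : S → ℝ) (s : S) (N : ℕ)
    (τ : Traj S A N) : ℝ := ∑ k ∈ range N, γ ^ k * td r γ V s τ k

theorem ret_cons {S A : Type*} [Nonempty A] (r : S → A → ℝ) (γ : ℝ)
    (V : S → ℝ) (s : S) (N : ℕ) (a : A) (x : S) (τ : Traj S A N) :
    ret r γ V s (N + 1) (consT a x τ)
      = (r s a + γ * V x - V s) + γ * ret r γ V x N τ := by
  unfold ret
  rw [Finset.sum_range_succ', add_comm, Finset.mul_sum]
  congr 1
  · have h := st_cons s a x τ 0 (Nat.zero_le _)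
    rw [td, h, ac_cons_zero]
    simp [st]
  · refine Finset.sum_congr rfl fun k hk => ?_
    have hk' : k < N := Finset.mem_range.1 hk
    rw [td, td, st_cons s a x τ k hk'.le, st_cons s a x τ (k + 1) hk', ac_cons_succ a x τ k hk']
    ring

theorem inner_eq {S A : Type*} [Fintype S] [Fintype A] [Nonempty A] (π : S → A → ℝ)
    (P : S → A → S → ℝ) (r : S → A → ℝ) (γ : ℝ) (V : S → ℝ)
    (hπsum : ∀ s₀ : S, ∑ a : A, π s₀ a = 1)
    (hPsum : ∀ (s₀ : S) (a : A), ∑ s' : S, P s₀ a s' = 1) (N : ℕ)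
    (h0 : ∀ s, expct π P s N (ret r γ V s N) = 0) (s : S) (b : A) :
    ∑ x : S, P s b x * expct π P x N (fun τ => ret r γ V s (N + 1) (consT b x τ))
      = r s b + γ * ∑ x : S, P s b x * V x - V s := by
  have h1 : ∀ x, P s b x * expct π P x N (fun τ => ret r γ V s (N + 1) (consT b x τ))
      = P s b x * (r s b - V s) + γ * (P s b x * V x) := by
    intro x
    simp only [ret_cons]
    rw [expct_add, expct_const π P hπsum hPsum, expct_smul, h0]
    ring
  simp only [h1, Finset.sum_add_distrib, ← Finset.sum_mul, ← Finset.mul_sum, hPsum]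
  ring

theorem expct_ret {S A : Type*} [Fintype S] [Fintype A] [Nonempty A] (π : S → A → ℝ)
    (P : S → A → S → ℝ) (r : S → A → ℝ) (γ : ℝ) (V : S → ℝ)
    (hπsum : ∀ s₀ : S, ∑ a : A, π s₀ a = 1)
    (hPsum : ∀ (s₀ : S) (a : A), ∑ s' : S, P s₀ a s' = 1)
    (hV : IsBellman π P r γ V) (N : ℕ) :
    ∀ s, expct π P s N (ret r γ V s N) = 0 := by
  induction N with
  | zero => intro s; simp [expct, ret]
  | succ N ih =>
    intro s
    rw [expct_succ]
    simp only [inner_eq π P r γ V hπsum hPsum N ih]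
    simp only [mul_sub, Finset.sum_sub_distrib, ← Finset.sum_mul, hπsum, one_mul]
    rw [← hV s, sub_self]

theorem expct_mcEst {S A : Type*} [Fintype S] [Fintype A] [Nonempty A] (π : S → A → ℝ)
    (P : S → A → S → ℝ) (r : S → A → ℝ) (γ : ℝ) (V : S → ℝ)
    (hπpos : ∀ s₀ a, 0 < π s₀ a)
    (hπsum : ∀ s₀ : S, ∑ a : A, π s₀ a = 1)
    (hPsum : ∀ (s₀ : S) (a : A), ∑ s' : S, P s₀ a s' = 1)
    (hV : IsBellman π P r γ V) (N : ℕ) (s : S) (a : A) :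
    expct π P s (N + 1) (mcEst π r γ V s (N + 1) a)
      = r s a + γ * ∑ x : S, P s a x * V x - V s := by
  rw [expct_succ, Finset.sum_eq_single a]
  · have h : ∀ x, (fun τ : Traj S A N => mcEst π r γ V s (N + 1) a (consT a x τ))
        = fun τ => (1 / π s a) * ret r γ V s (N + 1) (consT a x τ) := by
      intro x; funext τ
      simp only [mcEst, ac_cons_zero, if_true, ret]
    simp only [h, expct_smul]
    rw [← inner_eq π P r γ V hπsum hPsum N (expct_ret π P r γ V hπsum hPsum hV N) s a,
      Finset.mul_sum]
    refine Finset.sum_congr rfl fun x _ => ?_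
    have := (hπpos s a).ne'
    field_simp
  · intro b _ hb
    simp [mcEst, ac_cons_zero, hb, expct]
  · simp

theorem stmt_11 {S A : Type*} [Fintype S] [Fintype A] [Nonempty S] [Nonempty A]
    (π : S → A → ℝ) (P : S → A → S → ℝ) (r : S → A → ℝ) (γ : ℝ)
    (N : ℕ) (s : S)
    (hπpos : ∀ s₀ a, 0 < π s₀ a) (hπsum : ∀ s₀ : S, ∑ a : A, π s₀ a = 1)
    (hPnn : ∀ s₀ a s', 0 ≤ P s₀ a s') (hPsum : ∀ (s₀ : S) (a : A), ∑ s' : S, P s₀ a s' = 1)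
    (hγ0 : 0 ≤ γ) (hγ1 : γ ≤ 1) (hN : 1 ≤ N)
    (V : S → ℝ) (hV : IsBellman π P r γ V)
    (a a' : A) (hne : a ≠ a') :
    cv π P s N (mcEst π r γ V s N a) (mcEst π r γ V s N a')
      = -((r s a + γ * ∑ x : S, P s a x * V x - V s)
          * (r s a' + γ * ∑ x : S, P s a' x * V x - V s)) := by
  obtain ⟨M, rfl⟩ : ∃ M, N = M + 1 := ⟨N - 1, by omega⟩
  have ea := expct_mcEst π P r γ V hπpos hπsum hPsum hV M s a
  have ea' := expct_mcEst π P r γ V hπpos hπsum hPsum hV M s a'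
  unfold cv
  rw [← ea, ← ea']
  set u := expct π P s (M + 1) (mcEst π r γ V s (M + 1) a) with hu
  set v := expct π P s (M + 1) (mcEst π r γ V s (M + 1) a') with hv
  have h : (fun τ : Traj S A (M + 1) => (mcEst π r γ V s (M + 1) a τ - u)
        * (mcEst π r γ V s (M + 1) a' τ - v))
      = fun τ => (-v * mcEst π r γ V s (M + 1) a τ + -u * mcEst π r γ V s (M + 1) a' τ)
        + u * v := by
    funext τ
    have h0 : mcEst π r γ V s (M + 1) a τ * mcEst π r γ V s (M + 1) a' τ = 0 := by
      by_cases hc : ac τ 0 = a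
      · have : ac τ 0 ≠ a' := fun h => hne (hc.symm.trans h)
        simp [mcEst, this]
      · simp [mcEst, hc]
    linear_combination h0
  rw [h, expct_add, expct_add, expct_smul, expct_smul, expct_const π P hπsum hPsum, ← hu, ← hv]
  ring

end HCA
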